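/- arXiv:2211.13708 — 4 statements merged into one kernel-verified Lean document; each statement's English description precedes it below -/
import Mathlib

section
/- Let G be a simple graph and k ≥ 1. Let 𝒮 be a finite family of cliques of G, each with exactly k+1 vertices, such that for every Δ ∈ 𝒮 and every k-element subset Ω of Δ there exists Δ' ∈ 𝒮 with Δ' ≠ Δ and Ω ⊆ Δ'. Let U be the union of the vertex sets of the members of 𝒮. Then every vertex of U has at least k+1 neighbors lying in U; that is, U is (k+1)-closed, and hence U is contained in the (k+1)-core of G. -/
/-- A vertex set `W` is `k`-closed in `G` if every vertex of `W` has at least `k`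
neighbors lying in `W`. -/
def kClosed {V : Type*} (G : SimpleGraph V) (k : ℕ) (W : Set V) : Prop :=
  ∀ u ∈ W, (k : ℕ∞) ≤ (G.neighborSet u ∩ W).encard

/-- The `k`-core of `G` is the union of all `k`-closed subsets of the vertex set. -/
def kCore {V : Type*} (G : SimpleGraph V) (k : ℕ) : Set V :=
  ⋃₀ {W : Set V | kClosed G k W}

/-- If `𝒮` is a finite family of `(k+1)`-vertex cliques such that every `k`-element
subset of a member of `𝒮` is contained in another member of `𝒮`, then the union `U`
of the members of `𝒮` is `(k+1)`-closed, hence contained in the `(k+1)`-core. -/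
theorem cycle_support_in_core {V : Type*} [DecidableEq V] (G : SimpleGraph V)
    (k : ℕ) (hk : 1 ≤ k) (𝒮 : Finset (Finset V))
    (hclique : ∀ Δ ∈ 𝒮, G.IsClique (Δ : Set V))
    (hcard : ∀ Δ ∈ 𝒮, Δ.card = k + 1)
    (hface : ∀ Δ ∈ 𝒮, ∀ Ω ⊆ Δ, Ω.card = k → ∃ Δ' ∈ 𝒮, Δ' ≠ Δ ∧ Ω ⊆ Δ') :
    kClosed G (k + 1) (↑(𝒮.biUnion id) : Set V) ∧
      (↑(𝒮.biUnion id) : Set V) ⊆ kCore G (k + 1) := by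
  have closed : kClosed G (k + 1) (↑(𝒮.biUnion id) : Set V) := by
    intro u hu
    obtain ⟨Δ, hΔ, huΔ⟩ : ∃ Δ ∈ 𝒮, u ∈ Δ := by simpa using hu
    obtain ⟨v, hv, hvu⟩ := Finset.exists_mem_ne (s := Δ) (by rw [hcard Δ hΔ]; omega) u
    obtain ⟨Δ', hΔ', hne, hsub⟩ := hface Δ hΔ (Δ.erase v) (Finset.erase_subset v Δ)
      (by rw [Finset.card_erase_of_mem hv, hcard Δ hΔ, Nat.add_sub_cancel])
    have huΔ' : u ∈ Δ' := hsub (Finset.mem_erase.2 ⟨hvu.symm, huΔ⟩)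
    obtain ⟨w, hw, hwΔ⟩ : ∃ w ∈ Δ', w ∉ Δ := Finset.not_subset.1 fun h =>
      hne (Finset.eq_of_subset_of_card_le h (by rw [hcard Δ hΔ, hcard Δ' hΔ']))
    have card_eq : (insert w (Δ.erase u)).card = k + 1 := by
      rw [Finset.card_insert_of_notMem fun h => hwΔ (Finset.mem_of_mem_erase h),
        Finset.card_erase_of_mem huΔ, hcard Δ hΔ, Nat.add_sub_cancel]
    rw [← card_eq, ← Set.encard_coe_eq_coe_finsetCard]
    refine Set.encard_le_encard fun x hx => ?_
    rcases Finset.mem_insert.1 (Finset.mem_coe.1 hx) with rfl | hx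
    · exact ⟨hclique Δ' hΔ' huΔ' hw (ne_of_mem_of_not_mem huΔ hwΔ),
        Finset.mem_coe.2 (Finset.mem_biUnion.2 ⟨Δ', hΔ', hw⟩)⟩
    · obtain ⟨hxu, hxΔ⟩ := Finset.mem_erase.1 hx
      exact ⟨hclique Δ hΔ huΔ hxΔ hxu.symm,
        Finset.mem_coe.2 (Finset.mem_biUnion.2 ⟨Δ, hΔ, hxΔ⟩)⟩
  exact ⟨closed, Set.subset_sUnion_of_mem closed⟩
end

section
/- Let G be a simple graph with vertex set V, let f : V → ℝ be a filtering function, and let u and v be distinct vertices such that u is dominated by v and f(u) ≤ f(v). Then for every real threshold α with α ≤ f(u), the superlevel set W^α = {x ∈ V : f(x) ≥ α} contains both u and v, and u is dominated by v in the induced subgraph G[W^α]. (This is the key step in the superlevel-filtration version of the PrunIT theorem.) -/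
/-- The closed neighborhood of a vertex: the vertex together with all its neighbors. -/
def closedNbhd {V : Type*} (G : SimpleGraph V) (u : V) : Set V :=
  insert u (G.neighborSet u)

/-- `u` is dominated by `v` in `G` if `N(u) ⊆ N(v)` (closed neighborhoods). -/
def DominatedBy {V : Type*} (G : SimpleGraph V) (u v : V) : Prop :=
  closedNbhd G u ⊆ closedNbhd G v

theorem mem_closedNbhd {V : Type*} {G : SimpleGraph V} {u x : V} :
    x ∈ closedNbhd G u ↔ x = u ∨ G.Adj u x :=
  Iff.rfl

/-- Closed neighborhoods in an induced subgraph are restrictions of those in the whole graph. -/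
theorem closedNbhd_induce {V : Type*} (G : SimpleGraph V) (W : Set V) (u : W) :
    closedNbhd (G.induce W) u = Subtype.val ⁻¹' closedNbhd G u := by
  ext x
  simp [mem_closedNbhd, Subtype.ext_iff]

theorem DominatedBy.induce {V : Type*} {G : SimpleGraph V} {W : Set V} {u v : W}
    (h : DominatedBy G (u : V) v) : DominatedBy (G.induce W) u v := by
  simpa only [DominatedBy, closedNbhd_induce] using Set.preimage_mono h

/-- If `u` is dominated by `v` and `f u ≤ f v`, then every superlevel set at a
threshold `α ≤ f u` contains both `u` and `v`, and `u` is dominated by `v` in the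
induced subgraph on that superlevel set. -/
theorem dominatedBy_superlevel {V : Type*} (G : SimpleGraph V) (f : V → ℝ)
    (u v : V) (hne : u ≠ v) (hdom : DominatedBy G u v) (hf : f u ≤ f v)
    (α : ℝ) (hα : α ≤ f u) :
    ∃ (hu : u ∈ {x : V | α ≤ f x}) (hv : v ∈ {x : V | α ≤ f x}),
      DominatedBy (G.induce {x : V | α ≤ f x}) ⟨u, hu⟩ ⟨v, hv⟩ :=
  ⟨hα, hα.trans hf, DominatedBy.induce hdom⟩
end

section
/- Let G be a simple graph, let u and v be distinct vertices such that u is dominated by v, and let z and z' be vertices, each distinct from u, with z and z' reachable from each other in G. Then there exists a walk in G from z to z' of length dist_G(z, z') that does not pass through u. (In other words, no shortest path in G is forced to go through the dominated vertex u unless its endpoint is u.) -/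
/-- A map sending adjacent vertices to equal or adjacent ones sends a walk to a walk of at most the
same length whose vertices all lie in the range of the map. -/
theorem SimpleGraph.Walk.exists_length_le_of_adj_imp_eq_or_adj {V W : Type*} {G : SimpleGraph V}
    {H : SimpleGraph W} {f : V → W} (hf : ∀ ⦃a b⦄, G.Adj a b → f a = f b ∨ H.Adj (f a) (f b))
    {a b : V} (p : G.Walk a b) :
    ∃ q : H.Walk (f a) (f b), q.length ≤ p.length ∧ ∀ x ∈ q.support, x ∈ Set.range f := by
  induction p with
  | nil => exact ⟨.nil, by simp⟩
  | cons h p ih =>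
    obtain ⟨q, hq, hsupp⟩ := ih
    rcases hf h with heq | hadj
    · exact ⟨q.copy heq.symm rfl, by simp; omega, by simpa using hsupp⟩
    · exact ⟨.cons hadj q, by simpa using hq, by simpa using hsupp⟩

open Classical in
/-- Replacing a dominated vertex `u` by a vertex `v` dominating it sends adjacent vertices to equal
or adjacent ones. -/
theorem DominatedBy.update_eq_or_adj {V : Type*} {G : SimpleGraph V} {u v : V}
    (hdom : DominatedBy G u v) ⦃a b : V⦄ (hab : G.Adj a b) :
    Function.update id u v a = Function.update id u v b ∨
      G.Adj (Function.update id u v a) (Function.update id u v b) := by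
  have key : ∀ c, G.Adj u c → c = v ∨ G.Adj v c := fun c hc => by
    simpa [closedNbhd] using hdom (Set.mem_insert_of_mem u hc)
  by_cases ha : a = u
  · subst ha
    simpa [Function.update_of_ne hab.ne', eq_comm] using key b hab
  · by_cases hb : b = u
    · subst hb
      simpa [Function.update_of_ne ha, G.adj_comm] using key a hab.symm
    · simp [Function.update_of_ne ha, Function.update_of_ne hb, hab]

/-- If `u` is dominated by a distinct vertex `v`, then any two vertices `z, z'`
distinct from `u` that are reachable from each other admit a shortest walk (of length
`dist(z, z')`) avoiding `u`. -/
theorem shortest_walk_avoiding_dominated {V : Type*} (G : SimpleGraph V)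
    (u v z z' : V) (hne : u ≠ v) (hdom : DominatedBy G u v)
    (hz : z ≠ u) (hz' : z' ≠ u) (hr : G.Reachable z z') :
    ∃ p : G.Walk z z', p.length = G.dist z z' ∧ u ∉ p.support := by
  classical
  obtain ⟨p, hp⟩ := hr.exists_walk_length_eq_dist
  obtain ⟨q, hq, hsupp⟩ := p.exists_length_le_of_adj_imp_eq_or_adj hdom.update_eq_or_adj
  refine ⟨q.copy (Function.update_of_ne hz _ _) (Function.update_of_ne hz' _ _), ?_, ?_⟩
  · exact le_antisymm (by simpa [hp] using hq) (SimpleGraph.dist_le _)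
  · intro hu
    obtain ⟨x, hx⟩ := hsupp u (by simpa using hu)
    by_cases hxu : x = u
    · subst hxu
      exact hne (by simpa using hx.symm)
    · exact hxu (by simpa [Function.update_of_ne hxu] using hx)
end

section
/- Let G be a connected simple graph with vertex set V, and let u and v be distinct vertices such that u is dominated by v. Let G' = G[V \ {u}] be the subgraph induced on V \ {u}. Then G' is connected, and for all vertices z and z' distinct from u, dist_{G'}(z, z') = dist_G(z, z'). (Hence deleting a dominated vertex does not change distances among the remaining vertices, which is the key step in the proof of the PrunIT theorem for the power filtration.) -/
/-- A map sending each edge to an edge or to a single vertex sends walks to walks that are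
no longer. -/
theorem SimpleGraph.Walk.exists_length_le_of_map_adj {V W : Type*} {G : SimpleGraph V}
    {H : SimpleGraph W} (f : V → W) (hf : ∀ a b, G.Adj a b → f a = f b ∨ H.Adj (f a) (f b))
    {x y : V} (p : G.Walk x y) : ∃ q : H.Walk (f x) (f y), q.length ≤ p.length := by
  induction p with
  | nil => exact ⟨.nil, le_rfl⟩
  | cons h p ih =>
    obtain ⟨q, hq⟩ := ih
    rcases hf _ _ h with heq | hadj
    · exact ⟨q.copy heq.symm rfl, by simp; lia⟩
    · exact ⟨.cons hadj q, by simpa using hq⟩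

/-- Neighbors of a dominated vertex are equal or adjacent to the dominating vertex. -/
theorem DominatedBy.eq_or_adj {V : Type*} {G : SimpleGraph V} {u v w : V}
    (h : DominatedBy G u v) (hw : G.Adj u w) : w = v ∨ G.Adj v w :=
  h (Or.inr hw)

/-- Walks between vertices other than a dominated vertex `u` can be rerouted to avoid `u`
without becoming longer. -/
theorem DominatedBy.exists_walk_induce_compl {V : Type*} {G : SimpleGraph V} {u v : V}
    (hdom : DominatedBy G u v) (hne : u ≠ v) {z z' : ({u}ᶜ : Set V)}
    (p : G.Walk (z : V) (z' : V)) :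
    ∃ q : (G.induce ({u}ᶜ : Set V)).Walk z z', q.length ≤ p.length := by
  classical
  let f : V → ({u}ᶜ : Set V) := fun a => if h : a = u then ⟨v, hne.symm⟩ else ⟨a, h⟩
  have hf_self (a : ({u}ᶜ : Set V)) : f a = a := dif_neg a.2
  have hf : ∀ a b, G.Adj a b → f a = f b ∨ (G.induce ({u}ᶜ : Set V)).Adj (f a) (f b) := by
    intro a b hab
    by_cases ha : a = u <;> by_cases hb : b = u
    · exact Or.inl (by rw [ha, hb])
    · subst ha
      simpa [f, hb, Subtype.ext_iff] using (hdom.eq_or_adj hab).imp_left Eq.symm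
    · subst hb
      simpa [f, ha, Subtype.ext_iff, G.adj_comm] using hdom.eq_or_adj hab.symm
    · exact Or.inr (by simpa [f, ha, hb] using hab)
  obtain ⟨q, hq⟩ := p.exists_length_le_of_map_adj f hf
  exact ⟨q.copy (hf_self z) (hf_self z'), by simpa using hq⟩

/-- Deleting a dominated vertex from a connected graph keeps the graph connected and
does not change distances among the remaining vertices. -/
theorem induce_delete_dominated_connected_dist {V : Type*} (G : SimpleGraph V)
    (hconn : G.Connected) (u v : V) (hne : u ≠ v) (hdom : DominatedBy G u v) :
    (G.induce ({u}ᶜ : Set V)).Connected ∧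
      ∀ z z' : ({u}ᶜ : Set V),
        (G.induce ({u}ᶜ : Set V)).dist z z' = G.dist (z : V) (z' : V) := by
  have hconn' : (G.induce ({u}ᶜ : Set V)).Connected :=
    { preconnected := fun z z' =>
        let ⟨p⟩ := hconn.preconnected (z : V) (z' : V)
        let ⟨q, _⟩ := hdom.exists_walk_induce_compl hne p
        ⟨q⟩
      nonempty := ⟨⟨v, hne.symm⟩⟩ }
  refine ⟨hconn', fun z z' => le_antisymm ?_ ?_⟩
  · obtain ⟨p, hp⟩ := hconn.exists_walk_length_eq_dist (z : V) (z' : V)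
    obtain ⟨q, hq⟩ := hdom.exists_walk_induce_compl hne p
    exact (SimpleGraph.dist_le q).trans (hq.trans hp.le)
  · obtain ⟨q, hq⟩ := hconn'.exists_walk_length_eq_dist z z'
    rw [← hq, ← q.length_map (SimpleGraph.Embedding.induce _).toHom]
    exact SimpleGraph.dist_le _
end
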